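/- Let 𝓗 be an infinite-dimensional complex Hilbert space and let 𝓒_f(𝓗) be the set of closed elements of 𝓥_f(𝓗). Then (𝓒_f(𝓗); ⊕|_{𝓒_f(𝓗)}, o) is a generalized effect algebra; in particular, if t₁, t₂ ∈ 𝓒_f(𝓗) and t₁ ⊕ t₂ is defined in 𝓥_f(𝓗), then t₁ ⊕ t₂ is closed. -/

import Mathlib

set_option autoImplicit false

noncomputable section

open Filter

variable {H : Type*}

/-- A densely defined positive bilinear (sesquilinear) form on a complex Hilbert space `H`:
it is given by a dense domain `dom` and a map `toFun : H → H → ℂ` which is linear in the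
first argument and conjugate-linear in the second one on the domain, takes real nonnegative
values on the diagonal of the domain, and (as a normalization) vanishes off the domain. -/
structure PBF (H : Type*) [NormedAddCommGroup H] [InnerProductSpace ℂ H] where
  dom : Submodule ℂ H
  dense' : Dense (dom : Set H)
  toFun : H → H → ℂ
  zero_off : ∀ x y : H, x ∉ dom ∨ y ∉ dom → toFun x y = 0
  add_left : ∀ x y z : H, x ∈ dom → y ∈ dom → z ∈ dom →
    toFun (x + y) z = toFun x z + toFun y z
  smul_left : ∀ (c : ℂ) (x y : H), x ∈ dom → y ∈ dom →
    toFun (c • x) y = c * toFun x y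
  add_right : ∀ x y z : H, x ∈ dom → y ∈ dom → z ∈ dom →
    toFun x (y + z) = toFun x y + toFun x z
  smul_right : ∀ (c : ℂ) (x y : H), x ∈ dom → y ∈ dom →
    toFun x (c • y) = (starRingEnd ℂ) c * toFun x y
  re_nonneg : ∀ x : H, x ∈ dom → 0 ≤ (toFun x x).re
  im_zero : ∀ x : H, x ∈ dom → (toFun x x).im = 0

variable [NormedAddCommGroup H] [InnerProductSpace ℂ H]

namespace PBF

/-- A positive bilinear form is bounded if `sup {t(x,x) : x ∈ D(t), ‖x‖ = 1} < ∞`. -/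
def Bounded (t : PBF H) : Prop :=
  ∃ c : ℝ, ∀ x ∈ t.dom, (t.toFun x x).re ≤ c * ‖x‖ ^ 2

/-- Membership in `𝓥_f(𝓗)`: a positive bilinear form whose domain is all of `H`
whenever the form is bounded. -/
def InVf (t : PBF H) : Prop := t.Bounded → t.dom = ⊤

/-- `u` is the usual sum `t + s`, with domain `D(t) ⊓ D(s)`. -/
def IsSum (t s u : PBF H) : Prop :=
  u.dom = t.dom ⊓ s.dom ∧
  ∀ x y : H, x ∈ u.dom → y ∈ u.dom → u.toFun x y = t.toFun x y + s.toFun x y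

/-- Definedness of the partial operation `⊕` on `𝓥_f(𝓗)`:
`t ⊕ s` is defined iff `t` or `s` is bounded, or `D(t) = D(s)`. -/
def OplusDef (t s : PBF H) : Prop := t.Bounded ∨ s.Bounded ∨ t.dom = s.dom

/-- `t ⊕ s = u` in `𝓥_f(𝓗)`. -/
def Oplus (t s u : PBF H) : Prop := OplusDef t s ∧ IsSum t s u

/-- The squared norm `‖x‖_t² = t(x,x) + ‖x‖²` associated with the inner product
`(x,y)_t := t(x,y) + (x,y)` on `D(t)`. -/
def q (t : PBF H) (x : H) : ℝ := (t.toFun x x).re + ‖x‖ ^ 2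

/-- `t` is closed: `D(t)` is complete under the inner product `(x,y)_t := t(x,y) + (x,y)`
(sequential formulation of completeness). -/
def IsClosedForm (t : PBF H) : Prop :=
  ∀ f : ℕ → H, (∀ n, f n ∈ t.dom) →
    (∀ ε : ℝ, 0 < ε → ∃ N : ℕ, ∀ m ≥ N, ∀ n ≥ N, t.q (f m - f n) < ε) →
    ∃ x ∈ t.dom, Tendsto (fun n => t.q (f n - x)) atTop (nhds 0)

/-- `s` is an extension of `t` (i.e. `s|_{D(t)} = t`). -/
def Extends (s t : PBF H) : Prop :=
  t.dom ≤ s.dom ∧ ∀ x y : H, x ∈ t.dom → y ∈ t.dom → s.toFun x y = t.toFun x y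

/-- `t` is closable (equivalently, regular) iff it has a closed extension. -/
def Closable (t : PBF H) : Prop := ∃ s : PBF H, s.IsClosedForm ∧ s.Extends t

/-- `t` is singular: the only closable positive bilinear form `r` with `D(r) = D(t)` and
`r(x,x) ≤ t(x,x)` on `D(t)` is the zero form. -/
def Singular (t : PBF H) : Prop :=
  ∀ r : PBF H, r.Closable → r.dom = t.dom →
    (∀ x ∈ t.dom, (r.toFun x x).re ≤ (t.toFun x x).re) →
    ∀ x y : H, r.toFun x y = 0

/-- `tr` is the regular part of `t`: the largest closable positive bilinear form `r` with
`D(r) = D(t)` and `r(x,x) ≤ t(x,x)` for all `x ∈ D(t)` (Simon's decomposition theorem). -/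
def IsRegularPart (t tr : PBF H) : Prop :=
  tr.Closable ∧ tr.dom = t.dom ∧
  (∀ x ∈ t.dom, (tr.toFun x x).re ≤ (t.toFun x x).re) ∧
  ∀ r : PBF H, r.Closable → r.dom = t.dom →
    (∀ x ∈ t.dom, (r.toFun x x).re ≤ (t.toFun x x).re) →
    ∀ x ∈ t.dom, (r.toFun x x).re ≤ (tr.toFun x x).re

end PBF

/-- The zero form `o`, with `D(o) = 𝓗`. -/
def zeroPBF (H : Type*) [NormedAddCommGroup H] [InnerProductSpace ℂ H] : PBF H where
  dom := ⊤
  dense' := by rw [Submodule.top_coe]; exact dense_univ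
  toFun := fun _ _ => 0
  zero_off := fun _ _ _ => rfl
  add_left := by intros; simp
  smul_left := by intros; simp
  add_right := by intros; simp
  smul_right := by intros; simp
  re_nonneg := by intros; simp
  im_zero := by intros; simp

/-- `Q` is (the carrier of) a sub-generalized effect algebra of `(𝓥_f(𝓗); ⊕, o)`:
it contains `o`, and whenever `x ⊕ y = z` in `𝓥_f(𝓗)` with at least two of `x, y, z`
in `Q`, then all three are in `Q`. -/
def SubGEACond (Q : PBF H → Prop) : Prop :=
  Q (zeroPBF H) ∧
  ∀ x y z : PBF H, x.InVf → y.InVf → z.InVf → PBF.Oplus x y z →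
    ((Q x ∧ Q y) ∨ (Q x ∧ Q z) ∨ (Q y ∧ Q z)) → (Q x ∧ Q y ∧ Q z)

/-- Membership in the generalized effect algebra carried by `{t ∈ 𝓥_f(𝓗) : Q t}`. -/
def MemAlg (Q : PBF H → Prop) (t : PBF H) : Prop := t.InVf ∧ Q t

/-- The order induced by the restricted operation `⊕|_Q` on `{t ∈ 𝓥_f(𝓗) : Q t}`:
`s ≤ t` iff `s ⊕ r = t` for some `r` in the algebra. -/
def leQ (Q : PBF H → Prop) (s t : PBF H) : Prop :=
  ∃ r : PBF H, MemAlg Q r ∧ PBF.Oplus s r t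

/-- The order induced by `⊕` on `𝓥_f(𝓗)`: `s ≤ t` iff `s ⊕ r = t` for some `r ∈ 𝓥_f(𝓗)`. -/
def leVf (s t : PBF H) : Prop := ∃ r : PBF H, r.InVf ∧ PBF.Oplus s r t

/-- The algebra `{t ∈ 𝓥_f(𝓗) : Q t}` is monotone Dedekind upwards σ-complete: every
non-decreasing sequence dominated by some element has a supremum (w.r.t. the induced order). -/
def UpSigmaQ (Q : PBF H → Prop) : Prop :=
  ∀ f : ℕ → PBF H, (∀ n, MemAlg Q (f n)) → (∀ n, leQ Q (f n) (f (n + 1))) →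
    (∃ b : PBF H, MemAlg Q b ∧ ∀ n, leQ Q (f n) b) →
    ∃ s : PBF H, MemAlg Q s ∧ (∀ n, leQ Q (f n) s) ∧
      ∀ z : PBF H, MemAlg Q z → (∀ n, leQ Q (f n) z) → leQ Q s z

/-- The algebra `{t ∈ 𝓥_f(𝓗) : Q t}` is monotone Dedekind downwards σ-complete: every
non-increasing sequence has an infimum (w.r.t. the induced order). -/
def DownSigmaQ (Q : PBF H → Prop) : Prop :=
  ∀ f : ℕ → PBF H, (∀ n, MemAlg Q (f n)) → (∀ n, leQ Q (f (n + 1)) (f n)) →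
    ∃ i : PBF H, MemAlg Q i ∧ (∀ n, leQ Q i (f n)) ∧
      ∀ z : PBF H, MemAlg Q z → (∀ n, leQ Q z (f n)) → leQ Q z i

namespace PBF

theorem ext_of_dom {t s : PBF H} (hd : t.dom = s.dom)
    (h : ∀ x ∈ t.dom, ∀ y ∈ t.dom, t.toFun x y = s.toFun x y) : t = s := by
  have hf : t.toFun = s.toFun := by
    funext x y
    by_cases hx : x ∈ t.dom
    · by_cases hy : y ∈ t.dom
      · exact h x hx y hy
      · rw [t.zero_off x y (Or.inr hy), s.zero_off x y (Or.inr (hd ▸ hy))]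
    · rw [t.zero_off x y (Or.inl hx), s.zero_off x y (Or.inl (hd ▸ hx))]
  cases t
  cases s
  cases hd
  cases hf
  rfl

theorem conj_symm (t : PBF H) {x y : H} (hx : x ∈ t.dom) (hy : y ∈ t.dom) :
    (starRingEnd ℂ) (t.toFun x y) = t.toFun y x := by
  have hiy : Complex.I • y ∈ t.dom := t.dom.smul_mem _ hy
  have h₁ := t.im_zero (x + y) (add_mem hx hy)
  have h₂ := t.im_zero (x + Complex.I • y) (add_mem hx hiy)
  rw [t.add_left x y _ hx hy (add_mem hx hy), t.add_right x x y hx hx hy,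
    t.add_right y x y hy hx hy] at h₁
  rw [t.add_left x _ _ hx hiy (add_mem hx hiy), t.add_right x x _ hx hx hiy,
    t.add_right _ x _ hiy hx hiy, t.smul_right _ x y hx hy, t.smul_left _ y x hy hx,
    t.smul_left _ y _ hy hiy, t.smul_right _ y y hy hy] at h₂
  have hxx := t.im_zero x hx
  have hyy := t.im_zero y hy
  simp only [Complex.add_im, Complex.mul_im, Complex.mul_re, Complex.conj_I, Complex.neg_re,
    Complex.neg_im, Complex.I_re, Complex.I_im] at h₁ h₂
  apply Complex.ext
  · rw [Complex.conj_re]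
    linarith
  · rw [Complex.conj_im]
    linarith

/-- The semi-inner product `(x, y) ↦ t(y, x)` on the domain of `t`. -/
abbrev preCore (t : PBF H) : PreInnerProductSpace.Core ℂ t.dom where
  inner x y := t.toFun y x
  conj_inner_symm x y := t.conj_symm x.2 y.2
  re_inner_nonneg x := t.re_nonneg x x.2
  add_left x y z := t.add_right z x y z.2 x.2 y.2
  smul_left x y c := t.smul_right c y x y.2 x.2

theorem norm_sq_le (t : PBF H) {x y : H} (hx : x ∈ t.dom) (hy : y ∈ t.dom) :
    ‖t.toFun x y‖ ^ 2 ≤ (t.toFun x x).re * (t.toFun y y).re := by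
  have h := @InnerProductSpace.Core.inner_mul_inner_self_le ℂ t.dom _ _ _ t.preCore ⟨x, hx⟩ ⟨y, hy⟩
  have hn : ‖t.toFun y x‖ = ‖t.toFun x y‖ := by rw [← t.conj_symm hx hy, RCLike.norm_conj]
  change ‖t.toFun y x‖ * ‖t.toFun x y‖ ≤ (t.toFun x x).re * (t.toFun y y).re at h
  rwa [hn, ← sq] at h

theorem continuous_left {t : PBF H} (hb : t.Bounded) (hd : t.dom = ⊤) (y : H) :
    Continuous fun x => t.toFun x y := by
  have hm : ∀ x, x ∈ t.dom := fun x => hd ▸ Submodule.mem_top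
  obtain ⟨c, hc⟩ := hb
  let f : H →ₗ[ℂ] ℂ :=
    { toFun := fun x => t.toFun x y
      map_add' := fun a b => t.add_left a b y (hm a) (hm b) (hm y)
      map_smul' := fun a b => t.smul_left a b y (hm b) (hm y) }
  refine AddMonoidHomClass.continuous_of_bound f (Real.sqrt (|c| * (t.toFun y y).re)) fun x => ?_
  have hy := t.re_nonneg y (hm y)
  refine le_of_sq_le_sq ?_ (by positivity)
  rw [mul_pow, Real.sq_sqrt (by positivity)]
  calc ‖t.toFun x y‖ ^ 2 ≤ (t.toFun x x).re * (t.toFun y y).re := t.norm_sq_le (hm x) (hm y)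
    _ ≤ (|c| * ‖x‖ ^ 2) * (t.toFun y y).re := by
      gcongr
      exact (hc x (hm x)).trans (by gcongr; exact le_abs_self c)
    _ = _ := by ring

theorem eq_of_bounded_of_dense {t s : PBF H} (ht : t.Bounded) (htd : t.dom = ⊤)
    (hs : s.Bounded) (hsd : s.dom = ⊤) {D : Set H} (hD : Dense D)
    (h : ∀ x ∈ D, ∀ y ∈ D, t.toFun x y = s.toFun x y) : t = s := by
  have h₁ : ∀ y ∈ D, ∀ x, t.toFun x y = s.toFun x y := fun y hy x =>
    congrFun ((continuous_left ht htd y).ext_on hD (continuous_left hs hsd y)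
      fun x hx => h x hx y hy) x
  have h₂ : ∀ y x, t.toFun x y = s.toFun x y := fun y x =>
    congrFun ((continuous_left ht htd y).ext_on hD (continuous_left hs hsd y) fun x hx => by
      have hmt : ∀ x, x ∈ t.dom := fun x => htd ▸ Submodule.mem_top
      have hms : ∀ x, x ∈ s.dom := fun x => hsd ▸ Submodule.mem_top
      dsimp only
      rw [← t.conj_symm (hmt y) (hmt x), ← s.conj_symm (hms y) (hms x), h₁ x hx y]) x
  exact ext_of_dom (htd.trans hsd.symm) fun x _ y _ => h₂ y x

variable {t s r u v : PBF H}

theorem OplusDef.symm (h : OplusDef t s) : OplusDef s t := by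
  rcases h with h | h | h
  exacts [Or.inr (Or.inl h), Or.inl h, Or.inr (Or.inr h.symm)]

theorem IsSum.symm (h : IsSum t s u) : IsSum s t u :=
  ⟨by rw [h.1, inf_comm], fun x y hx hy => by rw [h.2 x y hx hy, add_comm]⟩

theorem Oplus.symm (h : Oplus t s u) : Oplus s t u :=
  ⟨h.1.symm, h.2.symm⟩

theorem IsSum.mem_left (h : IsSum t s u) {x : H} (hx : x ∈ u.dom) : x ∈ t.dom :=
  (h.1 ▸ hx : x ∈ t.dom ⊓ s.dom).1

theorem IsSum.mem_right (h : IsSum t s u) {x : H} (hx : x ∈ u.dom) : x ∈ s.dom :=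
  h.symm.mem_left hx

theorem IsSum.re_left_le (h : IsSum t s u) {x : H} (hx : x ∈ u.dom) :
    (t.toFun x x).re ≤ (u.toFun x x).re := by
  have := s.re_nonneg x (h.mem_right hx)
  rw [h.2 x x hx hx, Complex.add_re]
  linarith

theorem IsSum.q_left_le (h : IsSum t s u) {x : H} (hx : x ∈ u.dom) : t.q x ≤ u.q x :=
  add_le_add_left (h.re_left_le hx) _

theorem IsSum.q_le (h : IsSum t s u) {x : H} (hx : x ∈ u.dom) : u.q x ≤ t.q x + s.q x := by
  simp only [q, h.2 x x hx hx, Complex.add_re]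
  linarith [sq_nonneg ‖x‖]

theorem q_nonneg (t : PBF H) {x : H} (hx : x ∈ t.dom) : 0 ≤ t.q x :=
  add_nonneg (t.re_nonneg x hx) (sq_nonneg _)

theorem tendsto_of_tendsto_q {f : ℕ → H} (hf : ∀ n, f n ∈ t.dom) {x : H} (hx : x ∈ t.dom)
    (h : Tendsto (fun n => t.q (f n - x)) atTop (nhds 0)) : Tendsto f atTop (nhds x) := by
  rw [tendsto_iff_norm_sub_tendsto_zero]
  have h₂ : Tendsto (fun n => ‖f n - x‖ ^ 2) atTop (nhds 0) :=
    squeeze_zero (fun n => sq_nonneg _)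
      (fun n => le_add_of_nonneg_left (t.re_nonneg _ (sub_mem (hf n) hx))) h
  simpa using h₂.sqrt

theorem IsSum.isClosedForm (h : IsSum t s u) (ht : t.IsClosedForm) (hs : s.IsClosedForm) :
    u.IsClosedForm := by
  intro f hf hc
  have hft n := h.mem_left (hf n)
  have hfs n := h.mem_right (hf n)
  have hsub m n : f m - f n ∈ u.dom := sub_mem (hf m) (hf n)
  obtain ⟨x, hx, hxl⟩ := ht f hft fun ε hε => (hc ε hε).imp fun N hN m hm n hn =>
    (h.q_left_le (hsub m n)).trans_lt (hN m hm n hn)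
  obtain ⟨y, hy, hyl⟩ := hs f hfs fun ε hε => (hc ε hε).imp fun N hN m hm n hn =>
    (h.symm.q_left_le (hsub m n)).trans_lt (hN m hm n hn)
  obtain rfl := tendsto_nhds_unique (tendsto_of_tendsto_q hft hx hxl)
    (tendsto_of_tendsto_q hfs hy hyl)
  have hxu : x ∈ u.dom := h.1 ▸ ⟨hx, hy⟩
  refine ⟨x, hxu, squeeze_zero (fun n => u.q_nonneg (sub_mem (hf n) hxu))
    (fun n => h.q_le (sub_mem (hf n) hxu)) ?_⟩
  simpa using hxl.add hyl

theorem IsSum.unique (hu : IsSum t s u) (hv : IsSum t s v) : u = v :=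
  ext_of_dom (hu.1.trans hv.1.symm) fun x hx y hy => by
    have hd : u.dom = v.dom := hu.1.trans hv.1.symm
    rw [hu.2 x y hx hy, hv.2 x y (hd ▸ hx) (hd ▸ hy)]

theorem exists_isSum (t s : PBF H) (hd : Dense ((t.dom ⊓ s.dom : Submodule ℂ H) : Set H)) :
    ∃ u : PBF H, IsSum t s u := by
  classical
  refine ⟨{
    dom := t.dom ⊓ s.dom
    dense' := hd
    toFun := fun x y =>
      if x ∈ t.dom ⊓ s.dom ∧ y ∈ t.dom ⊓ s.dom then t.toFun x y + s.toFun x y else 0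
    zero_off := fun x y h => if_neg (by tauto)
    add_left := fun x y z hx hy hz => by
      rw [if_pos ⟨add_mem hx hy, hz⟩, if_pos ⟨hx, hz⟩, if_pos ⟨hy, hz⟩,
        t.add_left x y z hx.1 hy.1 hz.1, s.add_left x y z hx.2 hy.2 hz.2]
      ring
    smul_left := fun c x y hx hy => by
      rw [if_pos ⟨Submodule.smul_mem _ c hx, hy⟩, if_pos ⟨hx, hy⟩,
        t.smul_left c x y hx.1 hy.1, s.smul_left c x y hx.2 hy.2]
      ring
    add_right := fun x y z hx hy hz => by
      rw [if_pos ⟨hx, add_mem hy hz⟩, if_pos ⟨hx, hy⟩, if_pos ⟨hx, hz⟩,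
        t.add_right x y z hx.1 hy.1 hz.1, s.add_right x y z hx.2 hy.2 hz.2]
      ring
    smul_right := fun c x y hx hy => by
      rw [if_pos ⟨hx, Submodule.smul_mem _ c hy⟩, if_pos ⟨hx, hy⟩,
        t.smul_right c x y hx.1 hy.1, s.smul_right c x y hx.2 hy.2]
      ring
    re_nonneg := fun x hx => by
      rw [if_pos ⟨hx, hx⟩, Complex.add_re]
      exact add_nonneg (t.re_nonneg x hx.1) (s.re_nonneg x hx.2)
    im_zero := fun x hx => by
      rw [if_pos ⟨hx, hx⟩, Complex.add_im, t.im_zero x hx.1, s.im_zero x hx.2, add_zero] },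
    rfl, fun x y hx hy => if_pos ⟨hx, hy⟩⟩

theorem IsSum.bounded (h : IsSum t s u) (ht : t.Bounded) (hs : s.Bounded) : u.Bounded := by
  obtain ⟨c, hc⟩ := ht
  obtain ⟨d, hd⟩ := hs
  refine ⟨c + d, fun x hx => ?_⟩
  rw [h.2 x x hx hx, Complex.add_re, add_mul]
  exact add_le_add (hc x (h.mem_left hx)) (hd x (h.mem_right hx))

theorem IsSum.bounded_left (h : IsSum t s u) (hu : u.Bounded) (hd : u.dom = t.dom) :
    t.Bounded := by
  obtain ⟨c, hc⟩ := hu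
  exact ⟨c, fun x hx => (h.re_left_le (hd ▸ hx)).trans (hc x (hd ▸ hx))⟩

theorem IsSum.bounded_left_of_inVf (h : IsSum t s u) (hu : u.Bounded) (hv : u.InVf) :
    t.Bounded := by
  refine h.bounded_left hu (le_antisymm (fun x hx => h.mem_left hx) ?_)
  rw [hv hu]
  exact le_top

theorem IsSum.dom_eq_right (h : IsSum t s u) (ht : t.InVf) (hb : t.Bounded) : u.dom = s.dom := by
  rw [h.1, ht hb, top_inf_eq]

theorem Oplus.inVf (h : Oplus t s u) (ht : t.InVf) (hs : s.InVf) : u.InVf := by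
  intro hu
  obtain ⟨hd, h⟩ := h
  rcases hd with hb | hb | hb
  · have hd := h.dom_eq_right ht hb
    rw [hd]
    exact hs (h.symm.bounded_left hu hd)
  · have hd := h.symm.dom_eq_right hs hb
    rw [hd]
    exact ht (h.bounded_left hu hd)
  · have hd : u.dom = t.dom := by rw [h.1, ← hb, inf_idem]
    rw [hd]
    exact ht (h.bounded_left hu hd)

theorem OplusDef.dense_inf (h : OplusDef t s) (ht : t.InVf) (hs : s.InVf) :
    Dense ((t.dom ⊓ s.dom : Submodule ℂ H) : Set H) := by
  rcases h with hb | hb | hb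
  · rw [ht hb, top_inf_eq]
    exact s.dense'
  · rw [hs hb, inf_top_eq]
    exact t.dense'
  · rw [← hb, inf_idem]
    exact t.dense'

theorem OplusDef.exists_oplus (h : OplusDef t s) (ht : MemAlg IsClosedForm t)
    (hs : MemAlg IsClosedForm s) : ∃ u : PBF H, MemAlg IsClosedForm u ∧ Oplus t s u := by
  obtain ⟨u, hu⟩ := exists_isSum t s (h.dense_inf ht.1 hs.1)
  exact ⟨u, ⟨Oplus.inVf ⟨h, hu⟩ ht.1 hs.1, hu.isClosedForm ht.2 hs.2⟩, h, hu⟩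

theorem Oplus.dom_eq (h : Oplus t s u) (ht : t.InVf) (hs : ¬ s.Bounded) : u.dom = s.dom := by
  obtain ⟨hb | hb | hb, h⟩ := h
  · exact h.dom_eq_right ht hb
  · exact absurd hb hs
  · rw [h.1, hb, inf_idem]

theorem Oplus.oplusDef_right (h : Oplus t s u) (h' : Oplus u r v) (ht : t.InVf) (hu : u.InVf) :
    OplusDef s r := by
  by_cases hs : s.Bounded
  · exact Or.inl hs
  rcases h'.1 with hb | hb | hb
  · exact Or.inl (h.2.symm.bounded_left_of_inVf hb hu)
  · exact Or.inr (Or.inl hb)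
  · exact Or.inr (Or.inr ((h.dom_eq ht hs).symm.trans hb))

theorem Oplus.assoc_right {w : PBF H} (h : Oplus t s u) (h' : Oplus u r v) (hw : Oplus s r w)
    (hs : s.InVf) (hr : r.InVf) (hu : u.InVf) : Oplus t w v := by
  refine ⟨?_, ?_, fun x y hx hy => ?_⟩
  · by_cases ht : t.Bounded
    · exact Or.inl ht
    have hut := h.symm.dom_eq hs ht
    rcases h'.1 with hb | hb | hb
    · exact absurd (h.2.bounded_left_of_inVf hb hu) ht
    · rcases h.1 with hc | hc | hc
      · exact absurd hc ht
      · exact Or.inr (Or.inl (hw.2.bounded hc hb))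
      · exact Or.inr (Or.inr (hc.trans (hw.2.symm.dom_eq_right hr hb).symm))
    · refine Or.inr (Or.inr ?_)
      have hle : r.dom ≤ s.dom := fun x hx => h.2.mem_right (hb ▸ hx)
      rw [hw.2.1, inf_eq_right.2 hle, ← hb, hut]
  · rw [h'.2.1, h.2.1, hw.2.1, inf_assoc]
  · have hxu := h'.2.mem_left hx
    have hyu := h'.2.mem_left hy
    have hxw : x ∈ w.dom := hw.2.1 ▸ ⟨h.2.mem_right hxu, h'.2.mem_right hx⟩
    have hyw : y ∈ w.dom := hw.2.1 ▸ ⟨h.2.mem_right hyu, h'.2.mem_right hy⟩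
    rw [h'.2.2 x y hx hy, h.2.2 x y hxu hyu, hw.2.2 x y hxw hyw, add_assoc]

theorem Oplus.bounded_of_bounded (h : Oplus t s u) (h' : Oplus t r u) (ht : t.InVf)
    (hs : s.Bounded) : r.Bounded := by
  by_contra hr
  have hur := h'.dom_eq ht hr
  obtain ⟨c, hc⟩ := hs
  refine hr ⟨c, fun x hx => ?_⟩
  have hxu : x ∈ u.dom := hur ▸ hx
  have he := (h.2.2 x x hxu hxu).symm.trans (h'.2.2 x x hxu hxu)
  rw [← add_left_cancel he]
  exact hc x (h.2.mem_right hxu)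

theorem Oplus.cancel_left (h : Oplus t s u) (h' : Oplus t r u) (ht : t.InVf) (hs : s.InVf)
    (hr : r.InVf) : s = r := by
  have he : ∀ x ∈ u.dom, ∀ y ∈ u.dom, s.toFun x y = r.toFun x y := fun x hx y hy =>
    add_left_cancel ((h.2.2 x y hx hy).symm.trans (h'.2.2 x y hx hy))
  by_cases hb : s.Bounded
  · have hb' := h.bounded_of_bounded h' ht hb
    exact eq_of_bounded_of_dense hb (hs hb) hb' (hr hb') u.dense' he
  · have hb' : ¬ r.Bounded := fun hb' => hb (h'.bounded_of_bounded h ht hb')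
    have hus := h.dom_eq ht hb
    exact ext_of_dom (hus.symm.trans (h'.dom_eq ht hb')) (hus ▸ he)

theorem zeroPBF_isClosedForm [CompleteSpace H] : (zeroPBF H).IsClosedForm := by
  intro f _ hc
  have hq x : (zeroPBF H).q x = ‖x‖ ^ 2 := by simp [q, zeroPBF]
  simp only [hq] at hc ⊢
  have hf : CauchySeq f := Metric.cauchySeq_iff.2 fun ε hε =>
    (hc (ε ^ 2) (by positivity)).imp fun N hN m hm n hn => by
      rw [dist_eq_norm]
      exact lt_of_pow_lt_pow_left₀ 2 hε.le (hN m hm n hn)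
  obtain ⟨x, hx⟩ := cauchySeq_tendsto_of_complete hf
  refine ⟨x, Submodule.mem_top, ?_⟩
  simpa using (tendsto_iff_norm_sub_tendsto_zero.1 hx).pow 2

theorem oplus_zeroPBF (t : PBF H) : Oplus t (zeroPBF H) t :=
  ⟨Or.inr (Or.inl ⟨0, fun x _ => by simp [zeroPBF]⟩), (inf_top_eq t.dom).symm,
    fun x y _ _ => (add_zero (t.toFun x y)).symm⟩

theorem IsSum.eq_zeroPBF (h : IsSum t s (zeroPBF H)) : t = zeroPBF H := by
  have hd : t.dom = ⊤ := top_le_iff.1 fun x hx => h.mem_left hx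
  have hm : ∀ x, x ∈ t.dom := fun x => hd ▸ Submodule.mem_top
  refine ext_of_dom hd fun x hx y hy => ?_
  have hxx : (t.toFun x x).re ≤ 0 := h.re_left_le (x := x) Submodule.mem_top
  have h₁ := t.norm_sq_le hx hy
  have h₂ := mul_nonpos_of_nonpos_of_nonneg hxx (t.re_nonneg y hy)
  exact norm_eq_zero.1 (pow_eq_zero_iff two_ne_zero |>.1 (le_antisymm (h₁.trans h₂) (sq_nonneg _)))

end PBF

/-- `(𝓒_f(𝓗); ⊕|_{𝓒_f(𝓗)}, o)`, where `𝓒_f(𝓗)` is the set of closed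
elements of `𝓥_f(𝓗)`, is a generalized effect algebra; in particular, if
`t₁, t₂ ∈ 𝓒_f(𝓗)` and `t₁ ⊕ t₂` is defined in `𝓥_f(𝓗)` then `t₁ ⊕ t₂` is closed. -/
theorem stmt_7 [CompleteSpace H] (h_inf : ¬ FiniteDimensional ℂ H) :
    -- the sum of two closed forms of `𝓥_f(𝓗)`, when defined, is closed
    (∀ t s u : PBF H, t.InVf → s.InVf → t.IsClosedForm → s.IsClosedForm →
      PBF.Oplus t s u → u.IsClosedForm) ∧
    -- `o ∈ 𝓒_f(𝓗)`
    (zeroPBF H).InVf ∧ (zeroPBF H).IsClosedForm ∧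
    -- single valued
    (∀ t s u v : PBF H, PBF.IsSum t s u → PBF.IsSum t s v → u = v) ∧
    -- well defined into `𝓒_f(𝓗)`
    (∀ t s : PBF H, MemAlg PBF.IsClosedForm t → MemAlg PBF.IsClosedForm s →
      PBF.OplusDef t s → ∃ u : PBF H, MemAlg PBF.IsClosedForm u ∧ PBF.Oplus t s u) ∧
    -- (GEi) commutativity
    (∀ t s u : PBF H, MemAlg PBF.IsClosedForm t → MemAlg PBF.IsClosedForm s →
      PBF.Oplus t s u → PBF.Oplus s t u) ∧
    -- (GEii) associativity
    (∀ t s r u v : PBF H, MemAlg PBF.IsClosedForm t → MemAlg PBF.IsClosedForm s →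
      MemAlg PBF.IsClosedForm r → MemAlg PBF.IsClosedForm u → MemAlg PBF.IsClosedForm v →
      PBF.Oplus t s u → PBF.Oplus u r v →
      ∃ w : PBF H, MemAlg PBF.IsClosedForm w ∧ PBF.Oplus s r w ∧ PBF.Oplus t w v) ∧
    -- (GEiii) zero law
    (∀ t : PBF H, MemAlg PBF.IsClosedForm t → PBF.Oplus t (zeroPBF H) t) ∧
    -- (GEiv) cancellation
    (∀ t s r u : PBF H, MemAlg PBF.IsClosedForm t → MemAlg PBF.IsClosedForm s →
      MemAlg PBF.IsClosedForm r → PBF.Oplus t s u → PBF.Oplus t r u → s = r) ∧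
    -- (GEv) positivity
    (∀ t s : PBF H, MemAlg PBF.IsClosedForm t → MemAlg PBF.IsClosedForm s →
      PBF.Oplus t s (zeroPBF H) → t = zeroPBF H ∧ s = zeroPBF H) := by
  refine ⟨fun t s u _ _ ht hs h => h.2.isClosedForm ht hs, fun _ => rfl,
    PBF.zeroPBF_isClosedForm, fun t s u v hu hv => hu.unique hv,
    fun t s ht hs h => h.exists_oplus ht hs, fun t s u _ _ h => h.symm,
    fun t s r u v ht hs hr hu _ h h' => ?_, fun t _ => t.oplus_zeroPBF,
    fun t s r u ht hs hr h h' => h.cancel_left h' ht.1 hs.1 hr.1,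
    fun t s _ _ h => ⟨h.2.eq_zeroPBF, h.2.symm.eq_zeroPBF⟩⟩
  obtain ⟨w, hw, hsrw⟩ := (h.oplusDef_right h' ht.1 hu.1).exists_oplus hs hr
  exact ⟨w, hw, hsrw, h.assoc_right h' hsrw hs.1 hr.1 hu.1⟩
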